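/- arXiv:2506.00163 — 2 statements merged into one kernel-verified Lean document; each statement's English description precedes it below -/
import Mathlib

section
/- If N/N' is a derivation step of the constraint resolution calculus 𝒞, then N ⇛ N', i.e. the implication N → N' is valid (holds in every model under every assignment of the free predicate variables). -/
/- Common framework: first-order clause logic with equality, predicate symbols and
predicate variables; Tarskian semantics; the constraint resolution calculus 𝒞 of the
SCAN algorithm; resolution closures and the closure predicate Res^p_P; semantic
substitution of predicate expressions for predicate variables and witnesses for
second-order quantifier elimination. -/

namespace Scan

/-- First-order terms: individual variables, parameters (used as "fresh constants" c̄)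
and function applications (constants are 0-ary functions). -/
inductive Trm : Type
  | var : ℕ → Trm
  | param : ℕ → Trm
  | fn : ℕ → List Trm → Trm

/-- Atoms: equations, predicate-symbol atoms and predicate-variable atoms. -/
inductive Atm : Type
  | eq : Trm → Trm → Atm
  | pred : ℕ → List Trm → Atm
  | pvar : ℕ → List Trm → Atm

/-- A literal is a signed atom (`pos = true` for positive literals). -/
structure Lit : Type where
  pos : Bool
  atom : Atm

/-- The dual of a literal. -/
def Lit.dual (l : Lit) : Lit := ⟨!l.pos, l.atom⟩

/-- A clause is a multiset (disjunction) of literals, implicitly universally closed. -/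
abbrev Clause := Multiset Lit

/-- A pointed clause: a clause with a designated literal. -/
structure PClause : Type where
  lit : Lit
  rest : Clause

/-- The clause underlying a pointed clause. -/
def PClause.toClause (P : PClause) : Clause := P.lit ::ₘ P.rest

/-- A pointed clause is `X`-pointed if its designated literal is an `X`-literal. -/
def PClause.IsPointedAt (P : PClause) (X : ℕ) : Prop :=
  ∃ ts, P.lit.atom = Atm.pvar X ts

/-- The predicate variable of the designated literal, if any. -/
def pvarOf (P : PClause) : Option ℕ :=
  match P.lit.atom with
  | .pvar X _ => some X
  | _ => none

/-- Tarskian structures (with equality interpreted as identity); `par` interprets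
the parameters (fresh constants). -/
structure Str : Type 1 where
  dom : Type
  inh : Nonempty dom
  fn : ℕ → List dom → dom
  par : ℕ → dom
  pred : ℕ → List dom → Prop

/-- An assignment of the (free) predicate variables over a domain. -/
abbrev PredAssign (D : Type) := ℕ → List D → Prop

def evalTrm (M : Str) (v : ℕ → M.dom) : Trm → M.dom
  | .var n => v n
  | .param n => M.par n
  | .fn f ts => M.fn f (ts.attach.map fun t => evalTrm M v t.1)
decreasing_by
  have := List.sizeOf_lt_of_mem t.2
  simp only [Trm.fn.sizeOf_spec]
  omega

def Atm.terms : Atm → List Trm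
  | .eq t s => [t, s]
  | .pred _ ts => ts
  | .pvar _ ts => ts

def evalAtm (M : Str) (ρ : PredAssign M.dom) (v : ℕ → M.dom) : Atm → Prop
  | .eq t s => evalTrm M v t = evalTrm M v s
  | .pred p ts => M.pred p (ts.map (evalTrm M v))
  | .pvar X ts => ρ X (ts.map (evalTrm M v))

def evalLit (M : Str) (ρ : PredAssign M.dom) (v : ℕ → M.dom) (l : Lit) : Prop :=
  if l.pos then evalAtm M ρ v l.atom else ¬ evalAtm M ρ v l.atom

def evalClause (M : Str) (ρ : PredAssign M.dom) (v : ℕ → M.dom) (C : Clause) : Prop :=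
  ∃ l ∈ C, evalLit M ρ v l

/-- Truth of a (universally closed) clause. -/
def clauseTrue (M : Str) (ρ : PredAssign M.dom) (C : Clause) : Prop :=
  ∀ v : ℕ → M.dom, evalClause M ρ v C

/-- Truth of a clause set (universal closure of the conjunction of its clauses). -/
def setTrue (M : Str) (ρ : PredAssign M.dom) (N : Set Clause) : Prop :=
  ∀ C ∈ N, clauseTrue M ρ C

/-- Semantic entailment `N ⇛ N'` between clause sets: validity of the implication,
i.e. it holds in every structure under every assignment of the free predicate
variables. -/
def Entails (N N' : Set Clause) : Prop :=
  ∀ (M : Str) (ρ : PredAssign M.dom), setTrue M ρ N → setTrue M ρ N'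

/-- Logical equivalence of clause sets. -/
def EquivSets (N N' : Set Clause) : Prop :=
  ∀ (M : Str) (ρ : PredAssign M.dom), setTrue M ρ N ↔ setTrue M ρ N'

/-! ### Substitutions and unification -/

abbrev Subst := ℕ → Trm

def substTrm (σ : Subst) : Trm → Trm
  | .var n => σ n
  | .param n => .param n
  | .fn f ts => .fn f (ts.attach.map fun t => substTrm σ t.1)
decreasing_by
  have := List.sizeOf_lt_of_mem t.2
  simp only [Trm.fn.sizeOf_spec]
  omega

def substAtm (σ : Subst) : Atm → Atm
  | .eq t s => .eq (substTrm σ t) (substTrm σ s)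
  | .pred p ts => .pred p (ts.map (substTrm σ))
  | .pvar X ts => .pvar X (ts.map (substTrm σ))

def substLit (σ : Subst) (l : Lit) : Lit := ⟨l.pos, substAtm σ l.atom⟩

def substClause (σ : Subst) (C : Clause) : Clause := C.map (substLit σ)

/-- `σ` unifies the tuples of terms `ts` and `ss` componentwise. -/
def IsUnifier (σ : Subst) (ts ss : List Trm) : Prop :=
  ts.map (substTrm σ) = ss.map (substTrm σ)

def compSubst (σ τ : Subst) : Subst := fun n => substTrm τ (σ n)

/-- `σ` is a most general unifier of `ts` and `ss`. -/
def IsMGU (σ : Subst) (ts ss : List Trm) : Prop :=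
  IsUnifier σ ts ss ∧ ∀ τ, IsUnifier τ ts ss → ∃ ρ, τ = compSubst σ ρ

/-- A term contains a parameter. -/
inductive HasParam : Trm → Prop
  | param (n : ℕ) : HasParam (.param n)
  | fn {f : ℕ} {ts : List Trm} {t : Trm} : t ∈ ts → HasParam t → HasParam (.fn f ts)

/-- A clause is parameter-free (so the parameters are "fresh constants" for it). -/
def paramFree (C : Clause) : Prop :=
  ∀ l ∈ C, ∀ t ∈ l.atom.terms, ¬ HasParam t

def paramFreeSet (N : Set Clause) : Prop := ∀ C ∈ N, paramFree C

/-! ### The inference rules of SCAN -/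

/-- The constraint `t̄ ≉ s̄` as a list of disequation literals. -/
def neqLits (ts ss : List Trm) : List Lit :=
  (ts.zip ss).map fun p => ⟨false, .eq p.1 p.2⟩

/-- Constraint resolution upon an `X̄`-literal, `X̄` given as the set `Xs`:
from `C ∨ L(t̄)` and `D ∨ L(s̄)^⊥` infer `t̄ ≉ s̄ ∨ C ∨ D`. -/
def IsResolvent (Xs : Set ℕ) (C D R : Clause) : Prop :=
  ∃ (b : Bool) (X : ℕ) (ts ss : List Trm) (C' D' : Clause),
    X ∈ Xs ∧ ts.length = ss.length ∧
    C = (⟨b, .pvar X ts⟩ : Lit) ::ₘ C' ∧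
    D = (⟨!b, .pvar X ss⟩ : Lit) ::ₘ D' ∧
    R = ↑(neqLits ts ss) + C' + D'

/-- Constraint factoring upon `X̄`-literals: from `C ∨ L(t̄) ∨ L(s̄)` infer
`t̄ ≉ s̄ ∨ C ∨ L(t̄)`. -/
def IsFactor (Xs : Set ℕ) (C R : Clause) : Prop :=
  ∃ (b : Bool) (X : ℕ) (ts ss : List Trm) (C' : Clause),
    X ∈ Xs ∧ ts.length = ss.length ∧
    C = (⟨b, .pvar X ts⟩ : Lit) ::ₘ (⟨b, .pvar X ss⟩ : Lit) ::ₘ C' ∧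
    R = ↑(neqLits ts ss) + ((⟨b, .pvar X ts⟩ : Lit) ::ₘ C')

/-- Constraint elimination: from `t̄ ≉ s̄ ∨ C` infer `Cσ` for `σ` a most general
unifier of `t̄` and `s̄`. -/
def IsConstrElim (C R : Clause) : Prop :=
  ∃ (ts ss : List Trm) (C' : Clause) (σ : Subst),
    C = ↑(neqLits ts ss) + C' ∧ IsMGU σ ts ss ∧ R = substClause σ C'

/-- A resolvent between the clause `D` and the pointed clause `P` upon the
designated literal of `P`. -/
def IsPResolvent (P : PClause) (D R : Clause) : Prop :=
  ∃ (b : Bool) (X : ℕ) (ts ss : List Trm) (D' : Clause),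
    P.lit = ⟨b, .pvar X ts⟩ ∧ ts.length = ss.length ∧
    D = (⟨!b, .pvar X ss⟩ : Lit) ::ₘ D' ∧
    R = ↑(neqLits ts ss) + P.rest + D'

/-! ### Resolution closures and the closure predicate `Res^p_P` -/

/-- `Res_P(M)`: the smallest set of clauses containing `M` and closed under
resolvents with `P` upon the designated literal of `P`. -/
inductive InResClo (P : PClause) (M : Set Clause) : Clause → Prop
  | base {C : Clause} : C ∈ M → InResClo P M C
  | step {C R : Clause} : InResClo P M C → IsPResolvent P C R → InResClo P M R

def ResClo (P : PClause) (M : Set Clause) : Set Clause := {C | InResClo P M C}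

/-- The tuple of fresh constants `c̄ = (c₀, …, c_{k-1})` as parameters. -/
def cparams (k : ℕ) : List Trm := (List.range k).map Trm.param

/-- `Res^U_P(c̄) = Res_P({L(c̄)^⊥})`, where `L(t̄)` is the designated literal of `P`
and `c̄` is the tuple of fresh constants (parameters). -/
def ResU (P : PClause) : Set Clause :=
  {C | ∃ X ts, P.lit.atom = Atm.pvar X ts ∧
      InResClo P {((⟨!P.lit.pos, Atm.pvar X (cparams ts.length)⟩ : Lit) ::ₘ (0 : Clause))} C}

/-- Reinterpret the parameters `c̄` as the tuple `ds` of domain elements. -/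
def withPar (M : Str) (ds : List M.dom) : Str :=
  { M with par := fun n => ds.getD n (M.par n) }

/-- The (possibly infinitary) closure predicate `Res^p_P`, given semantically: its
value on a structure `M`, an assignment `ρ` of the predicate variables and a tuple
`ds` of arguments (the values of the λ-abstracted variables `ū`, substituted for
the fresh constants `c̄`).  For a negative designated literal it is
`λū.⋀_{C'∈Res^U_P(c̄)} ∀v̄ C'(ū,v̄)`, for a positive one
`λū.⋁_{C'∈Res^U_P(c̄)} ∃v̄ ¬C'(ū,v̄)`. -/
def ResPred (P : PClause) (M : Str) (ρ : PredAssign M.dom) (ds : List M.dom) : Prop :=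
  if P.lit.pos then
    ∃ C ∈ ResU P, ∃ v : ℕ → M.dom, ¬ evalClause (withPar M ds) ρ v C
  else
    ∀ C ∈ ResU P, ∀ v : ℕ → M.dom, evalClause (withPar M ds) ρ v C

/-! ### Semantic substitution of predicate expressions and witnesses -/

/-- Update a predicate assignment at the single predicate variable `X`. -/
def updP1 {D : Type} (ρ : PredAssign D) (X : ℕ) (Q : List D → Prop) : PredAssign D :=
  fun Y => if Y = X then Q else ρ Y

/-- Update a predicate assignment simultaneously at the tuple `X̄ = Xs` (assumed
injective) of predicate variables.  This realizes the simultaneous substitution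
`[X̄ ← ᾱ]` semantically. -/
def updP {D : Type} {d : ℕ} (ρ : PredAssign D) (Xs : Fin d → ℕ)
    (Ps : Fin d → List D → Prop) : PredAssign D :=
  fun Y ds => (∃ i, Xs i = Y ∧ Ps i ds) ∨ ((∀ i, Xs i ≠ Y) ∧ ρ Y ds)

/-- A (possibly infinitary, possibly second-order) predicate expression, given by
its semantics: for every structure and assignment of the free predicate variables,
a predicate on tuples of domain elements. -/
abbrev SemPred : Type 1 := (M : Str) → PredAssign M.dom → List M.dom → Prop

/-- `ᾱ = αs` is an (elimination) witness for `∃X̄ N`: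
`∃X̄ N ⟺ N[X̄ ← ᾱ]`, where the substitution is taken semantically. -/
def IsWitness {d : ℕ} (Xs : Fin d → ℕ) (αs : Fin d → SemPred) (N : Set Clause) : Prop :=
  ∀ (M : Str) (ρ : PredAssign M.dom),
    (∃ Ps : Fin d → List M.dom → Prop, setTrue M (updP ρ Xs Ps) N) ↔
      setTrue M (updP ρ Xs (fun i => αs i M ρ)) N

/-- Logical equivalence `∃X̄ N ⟺ ∃X̄ N'`. -/
def ExEquiv {d : ℕ} (Xs : Fin d → ℕ) (N N' : Set Clause) : Prop :=
  ∀ (M : Str) (ρ : PredAssign M.dom),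
    (∃ Ps : Fin d → List M.dom → Prop, setTrue M (updP ρ Xs Ps) N) ↔
      (∃ Ps : Fin d → List M.dom → Prop, setTrue M (updP ρ Xs Ps) N')

/-! ### Occurrences of predicate variables -/

/-- `X` occurs in `C` with polarity `b`. -/
def OccursPol (X : ℕ) (b : Bool) (C : Clause) : Prop :=
  ∃ l ∈ C, l.pos = b ∧ ∃ ts, l.atom = Atm.pvar X ts

/-- `X` occurs in `C`. -/
def OccursIn (X : ℕ) (C : Clause) : Prop := ∃ b, OccursPol X b C

/-- An `X`-pointed clause is one-sided if `X` occurs in it only with the polarity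
of the designated literal. -/
def OneSided (P : PClause) : Prop :=
  ∀ X ts, P.lit.atom = Atm.pvar X ts →
    ∀ l ∈ P.rest, ∀ ss, l.atom = Atm.pvar X ss → l.pos = P.lit.pos

/-! ### The calculus 𝒞 -/

/-- The derivation steps of the constraint resolution calculus 𝒞 (with the data
determining them). -/
inductive CStep : Type
  | res (C D R : Clause)
  | fac (C R : Clause)
  | celim (C R : Clause)
  | redElim (C : Clause)
  | extPurDel (X : ℕ) (b : Bool)
  | purDel (P : PClause)

/-- Side conditions for a 𝒞-derivation step from the clause set `N`; `Xs` is the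
set of existentially quantified predicate variables `X̄` and `Red C N` is the
ambient redundancy notion ("`C` is redundant in `N`"). -/
def CStep.ok (Xs : Set ℕ) (Red : Clause → Set Clause → Prop) (N : Set Clause) :
    CStep → Prop
  | .res C D R => C ∈ N ∧ D ∈ N ∧ IsResolvent Xs C D R
  | .fac C R => C ∈ N ∧ IsFactor Xs C R
  | .celim C R => C ∈ N ∧ IsConstrElim C R
  | .redElim C => C ∈ N ∧ Red C N
  | .extPurDel X b => X ∈ Xs ∧ ∀ C ∈ N, OccursIn X C → OccursPol X b C
  | .purDel P => (∃ X ∈ Xs, P.IsPointedAt X) ∧ P.toClause ∈ N ∧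
      ∀ D ∈ N \ {P.toClause}, ∀ R, IsPResolvent P D R → Red R (N \ {P.toClause})

/-- The conclusion of a 𝒞-derivation step. -/
def CStep.apply (N : Set Clause) : CStep → Set Clause
  | .res _ _ R => N ∪ {R}
  | .fac _ R => N ∪ {R}
  | .celim _ R => N ∪ {R}
  | .redElim C => N \ {C}
  | .extPurDel X _ => {C ∈ N | ¬ OccursIn X C}
  | .purDel P => N \ {P.toClause}

/-- Redundancy is compatible with entailment: a redundant clause is entailed. -/
def RedCompat (Red : Clause → Set Clause → Prop) : Prop :=
  ∀ C N, Red C N →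
    ∀ (M : Str) (ρ : PredAssign M.dom), setTrue M ρ N → clauseTrue M ρ C

/-- Redundancy elimination is equivalence-preserving. -/
def RedEquiv (Red : Clause → Set Clause → Prop) : Prop :=
  ∀ C N, C ∈ N → Red C N →
    ∀ (M : Str) (ρ : PredAssign M.dom), (setTrue M ρ (N \ {C}) ↔ setTrue M ρ N)

/-! ### Derivations and the witness transformation -/

/-- All steps of the derivation `D` from `N` satisfy their side conditions. -/
def derivOK (Xs : Set ℕ) (Red : Clause → Set Clause → Prop) :
    Set Clause → List CStep → Prop
  | _, [] => True
  | N, S :: D => CStep.ok Xs Red N S ∧ derivOK Xs Red (CStep.apply N S) D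

/-- The conclusion of the derivation `D` from `N`. -/
def applyDeriv : Set Clause → List CStep → Set Clause
  | N, [] => N
  | N, S :: D => applyDeriv (CStep.apply N S) D

/-- The witness transformation `T_S`: identity for inference and redundancy
elimination steps, `λū.⊤` resp. `λū.⊥` at the `X`-component for extended purity
deletion, and `Res^p_P[X̄ ← ᾱ]` at the `X_i`-component for deletion of the purified
`X_i`-pointed clause `P`. -/
def Twit {d : ℕ} (Xs : Fin d → ℕ) (S : CStep) (αs : Fin d → SemPred) :
    Fin d → SemPred :=
  match S with
  | .extPurDel X b =>
      fun i => if Xs i = X then (fun _M _ρ _ds => b = true) else αs i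
  | .purDel P =>
      fun i => if pvarOf P = some (Xs i) then
          (fun M ρ ds => ResPred P M (updP ρ Xs (fun j => αs j M ρ)) ds)
        else αs i
  | _ => αs

/-- `wit(D)` constructed backwards from the base (placeholder) witness:
`wit_m = base`, `wit_{i-1} = T_{D_i}(wit_i)`. -/
def witDeriv {d : ℕ} (Xs : Fin d → ℕ) (base : Fin d → SemPred) (D : List CStep) :
    Fin d → SemPred :=
  D.foldr (fun S acc => Twit Xs S acc) base

/-- The transformation `T'_S` (predicate-variable form of `T_S`), given
semantically: the tuple of predicates substituted for `X̄`. -/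
def TPrime {d : ℕ} (Xs : Fin d → ℕ) (S : CStep) (M : Str) (ρ : PredAssign M.dom) :
    Fin d → List M.dom → Prop :=
  match S with
  | .extPurDel X b => fun i => if Xs i = X then (fun _ => b = true) else ρ (Xs i)
  | .purDel P => fun i => if pvarOf P = some (Xs i) then ResPred P M ρ else ρ (Xs i)
  | _ => fun i => ρ (Xs i)


section Semantics

variable {M : Str} {ρ : PredAssign M.dom}

theorem setTrue.mono {N N' : Set Clause} (h : setTrue M ρ N) (hN : N' ⊆ N) :
    setTrue M ρ N' :=
  fun C hC => h C (hN hC)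

theorem setTrue.union_singleton {N : Set Clause} {C : Clause} (h : setTrue M ρ N)
    (hC : clauseTrue M ρ C) : setTrue M ρ (N ∪ {C}) := by
  rintro D (hD | rfl)
  exacts [h D hD, hC]

theorem evalTrm_substTrm (v : ℕ → M.dom) (σ : Subst) :
    ∀ t : Trm, evalTrm M v (substTrm σ t) = evalTrm M (fun n => evalTrm M v (σ n)) t
  | .var n => by simp [substTrm, evalTrm]
  | .param n => by simp [substTrm, evalTrm]
  | .fn f ts => by
    simp only [substTrm, evalTrm, List.map_subtype,
      List.unattach_attach, List.map_map]
    congr 1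
    refine List.map_congr_left fun t ht => ?_
    exact evalTrm_substTrm v σ t
termination_by t => t
decreasing_by
  have := List.sizeOf_lt_of_mem ht
  simp only [Trm.fn.sizeOf_spec]
  omega

theorem evalLit_substLit (v : ℕ → M.dom) (σ : Subst) (l : Lit) :
    evalLit M ρ v (substLit σ l) ↔ evalLit M ρ (fun n => evalTrm M v (σ n)) l := by
  have h : evalTrm M v ∘ substTrm σ = evalTrm M (fun n => evalTrm M v (σ n)) :=
    funext (evalTrm_substTrm v σ)
  rcases l with ⟨b, a⟩
  cases a <;> simp [evalLit, substLit, substAtm, evalAtm, evalTrm_substTrm, h]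

theorem evalClause_substClause (v : ℕ → M.dom) (σ : Subst) (C : Clause) :
    evalClause M ρ v (substClause σ C) ↔
      evalClause M ρ (fun n => evalTrm M v (σ n)) C := by
  simp [evalClause, substClause, evalLit_substLit]

@[simp]
theorem evalClause_cons {v : ℕ → M.dom} {l : Lit} {C : Clause} :
    evalClause M ρ v (l ::ₘ C) ↔ evalLit M ρ v l ∨ evalClause M ρ v C := by
  simp [evalClause]

@[simp]
theorem evalClause_add {v : ℕ → M.dom} {C D : Clause} :
    evalClause M ρ v (C + D) ↔ evalClause M ρ v C ∨ evalClause M ρ v D := by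
  simp [evalClause, or_and_right, exists_or]

/-- The constraint `t̄ ≉ s̄` says that the tuples have different values. -/
theorem evalClause_neqLits {v : ℕ → M.dom} {ts ss : List Trm}
    (hlen : ts.length = ss.length) :
    evalClause M ρ v ↑(neqLits ts ss) ↔ ts.map (evalTrm M v) ≠ ss.map (evalTrm M v) := by
  induction ts generalizing ss with
  | nil =>
    obtain rfl := List.length_eq_zero_iff.mp hlen.symm
    simp [neqLits, evalClause]
  | cons t ts ih =>
    obtain _ | ⟨s, ss⟩ := ss
    · simp at hlen
    · have hcons : (↑(neqLits (t :: ts) (s :: ss)) : Clause) =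
          (⟨false, .eq t s⟩ : Lit) ::ₘ ↑(neqLits ts ss) := rfl
      rw [hcons, evalClause_cons, ih (by simpa using hlen)]
      simp only [evalLit, evalAtm, List.map_cons, ne_eq, List.cons.injEq, not_and_or]
      simp

theorem IsResolvent.clauseTrue {Xs : Set ℕ} {C D R : Clause} (h : IsResolvent Xs C D R)
    (hC : clauseTrue M ρ C) (hD : clauseTrue M ρ D) : clauseTrue M ρ R := by
  obtain ⟨b, X, ts, ss, C', D', -, hlen, rfl, rfl, rfl⟩ := h
  intro v
  have hCv := hC v
  have hDv := hD v
  simp only [evalClause_cons, evalClause_add, evalClause_neqLits hlen] at hCv hDv ⊢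
  by_cases he : ts.map (evalTrm M v) = ss.map (evalTrm M v)
  · cases b <;> simp [evalLit, evalAtm, he] at hCv hDv ⊢ <;> tauto
  · exact .inl (.inl he)

theorem IsFactor.clauseTrue {Xs : Set ℕ} {C R : Clause} (h : IsFactor Xs C R)
    (hC : clauseTrue M ρ C) : clauseTrue M ρ R := by
  obtain ⟨b, X, ts, ss, C', -, hlen, rfl, rfl⟩ := h
  intro v
  have hCv := hC v
  simp only [evalClause_cons, evalClause_add, evalClause_neqLits hlen] at hCv ⊢
  by_cases he : ts.map (evalTrm M v) = ss.map (evalTrm M v)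
  · simp only [evalLit, evalAtm, he] at hCv ⊢
    tauto
  · exact .inl he

theorem IsConstrElim.clauseTrue {C R : Clause} (h : IsConstrElim C R)
    (hC : clauseTrue M ρ C) : clauseTrue M ρ R := by
  obtain ⟨ts, ss, C', σ, rfl, ⟨hσ, -⟩, rfl⟩ := h
  intro v
  have hlen : ts.length = ss.length := by simpa using congrArg List.length hσ
  have he := congrArg (List.map (evalTrm M v)) hσ
  simp only [List.map_map, Function.comp_def, evalTrm_substTrm] at he
  rw [evalClause_substClause]
  exact (evalClause_add.mp (hC _)).resolve_left
    fun hn => (evalClause_neqLits hlen).mp hn he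

end Semantics

/-- If `N/N'` is a derivation step of the constraint resolution
calculus 𝒞, then `N ⇛ N'`: the implication `N → N'` holds in every structure
under every assignment of the free predicate variables. -/
theorem step_is_sound
    {d : ℕ} (Xs : Fin d → ℕ) (hXs : Function.Injective Xs)
    (Red : Clause → Set Clause → Prop)
    (hRed₁ : RedCompat Red) (hRed₂ : RedEquiv Red)
    (N : Set Clause)
    (S : CStep) (hok : CStep.ok (Set.range Xs) Red N S) :
    Entails N (CStep.apply N S) := by
  intro M ρ h
  cases S with
  | res C D R => exact h.union_singleton (hok.2.2.clauseTrue (h C hok.1) (h D hok.2.1))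
  | fac C R => exact h.union_singleton (hok.2.clauseTrue (h C hok.1))
  | celim C R => exact h.union_singleton (hok.2.clauseTrue (h C hok.1))
  | redElim C => exact h.mono Set.sdiff_subset
  | extPurDel X b => exact h.mono (Set.sep_subset _ _)
  | purDel P => exact h.mono Set.sdiff_subset

end Scan
end

section
/- Lower bound on witness size: for all natural numbers p ≥ 1 and n ≥ 1 there exist a clause set N_{p,n} and a one-sided X-eliminating 𝒞-derivation D_{p,n} from N_{p,n} with exactly p purified pointed clauses, each with at most n X-literals and n the maximum such number, such that: if n = 1 then |wit(D_{p,n})| = Ω(p) as p → ∞, and if n > 1 then |wit(D_{p,n})| = Ω(n^p) as p → ∞. (One may take N_{p,n} = { ⋁_{j=1}^n X(c_{i,j}) | 1 ≤ i ≤ p } for pairwise distinct constants c_{i,j} and D_{p,n} the derivation deleting the pointed clauses P_i = X(c_{i,1}) ∨ ⋁_{j=2}^n X(c_{i,j}) one after another by purified clause deletion.) -/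
/- Common framework: first-order clause logic with equality, predicate symbols and
predicate variables; Tarskian semantics; the constraint resolution calculus 𝒞 of the
SCAN algorithm; resolution closures and the closure predicate Res^p_P; semantic
substitution of predicate expressions for predicate variables and witnesses for
second-order quantifier elimination. -/

namespace Scan

/-! ### Finitary first-order formulas and first-order predicates -/

/-- Finitary first-order formulas over the signature (predicate variables may
occur as atoms). -/
inductive Fml : Type
  | atom : Atm → Fml
  | tru : Fml
  | fls : Fml
  | not : Fml → Fml
  | and : Fml → Fml → Fml
  | or : Fml → Fml → Fml
  | imp : Fml → Fml → Fml
  | all : ℕ → Fml → Fml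
  | ex : ℕ → Fml → Fml

def evalFml (M : Str) (ρ : PredAssign M.dom) : Fml → (ℕ → M.dom) → Prop
  | .atom a, v => evalAtm M ρ v a
  | .tru, _ => True
  | .fls, _ => False
  | .not φ, v => ¬ evalFml M ρ φ v
  | .and φ ψ, v => evalFml M ρ φ v ∧ evalFml M ρ ψ v
  | .or φ ψ, v => evalFml M ρ φ v ∨ evalFml M ρ ψ v
  | .imp φ ψ, v => evalFml M ρ φ v → evalFml M ρ ψ v
  | .all n φ, v => ∀ a : M.dom, evalFml M ρ φ (Function.update v n a)
  | .ex n φ, v => ∃ a : M.dom, evalFml M ρ φ (Function.update v n a)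

/-- A first-order predicate `λū.φ(ū)`: the λ-abstracted variables `ū` are the
individual variables `0, …, arity-1` of the first-order body. -/
structure FOPred : Type where
  arity : ℕ
  body : Fml

/-- The semantics of a first-order predicate as a predicate expression. -/
noncomputable def FOPred.toSem (e : FOPred) : SemPred :=
  fun M ρ ds => evalFml M ρ e.body (fun n => ds.getD n (Classical.choice M.inh))

/-- All free individual variables of the body are among the λ-abstracted ones. -/
def FOPred.Closed (e : FOPred) : Prop :=
  ∀ (M : Str) (ρ : PredAssign M.dom) (v w : ℕ → M.dom),
    (∀ n < e.arity, v n = w n) → (evalFml M ρ e.body v ↔ evalFml M ρ e.body w)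

/-- A predicate expression is (equivalent to) a first-order predicate of arity
`ar`. -/
def IsFOPredicate (ar : ℕ) (α : SemPred) : Prop :=
  ∃ e : FOPred, e.arity = ar ∧ e.Closed ∧
    ∀ (M : Str) (ρ : PredAssign M.dom) (ds : List M.dom), ds.length = ar →
      (α M ρ ds ↔ e.toSem M ρ ds)

/-! ### Syntactic witness construction for one-sided derivations, and sizes -/

def sizeT : Trm → ℕ
  | .var _ => 1
  | .param _ => 1
  | .fn _ ts => 1 + (ts.attach.map fun t => sizeT t.1).sum
decreasing_by
  have := List.sizeOf_lt_of_mem t.2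
  simp only [Trm.fn.sizeOf_spec]
  omega

def sizeA : Atm → ℕ
  | .eq t s => 1 + sizeT t + sizeT s
  | .pred _ ts => 1 + (ts.map sizeT).sum
  | .pvar _ ts => 1 + (ts.map sizeT).sum

/-- The size of a formula: constants, variables, ⊤, ⊥ count 1; applications add 1
to the sizes of the arguments; ¬ and quantifiers add 1; binary connectives sum the
sizes of the parts (λ-abstraction does not increase the size). -/
def sizeF : Fml → ℕ
  | .atom a => sizeA a
  | .tru => 1
  | .fls => 1
  | .not φ => 1 + sizeF φ
  | .and φ ψ => sizeF φ + sizeF ψ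
  | .or φ ψ => sizeF φ + sizeF ψ
  | .imp φ ψ => sizeF φ + sizeF ψ
  | .all _ φ => 1 + sizeF φ
  | .ex _ φ => 1 + sizeF φ

/-- Substitution of terms for individual variables in a formula. -/
def substTF (σ : Subst) : Fml → Fml
  | .atom a => .atom (substAtm σ a)
  | .tru => .tru
  | .fls => .fls
  | .not φ => .not (substTF σ φ)
  | .and φ ψ => .and (substTF σ φ) (substTF σ ψ)
  | .or φ ψ => .or (substTF σ φ) (substTF σ ψ)
  | .imp φ ψ => .imp (substTF σ φ) (substTF σ ψ)
  | .all n φ => .all n (substTF σ φ)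
  | .ex n φ => .ex n (substTF σ φ)

/-- Simultaneous substitution of first-order predicates for predicate variables:
an occurrence `X(t̄)` is replaced by the body of the predicate substituted for `X`
with `t̄` substituted for its λ-abstracted variables. -/
def substPvF (sub : ℕ → Option FOPred) : Fml → Fml
  | .atom (.pvar X ts) =>
    (match sub X with
     | some e => substTF (fun n => ts.getD n (.var n)) e.body
     | none => .atom (.pvar X ts))
  | .atom a => .atom a
  | .tru => .tru
  | .fls => .fls
  | .not φ => .not (substPvF sub φ)
  | .and φ ψ => .and (substPvF sub φ) (substPvF sub ψ)
  | .or φ ψ => .or (substPvF sub φ) (substPvF sub ψ)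
  | .imp φ ψ => .imp (substPvF sub φ) (substPvF sub ψ)
  | .all n φ => .all n (substPvF sub φ)
  | .ex n φ => .ex n (substPvF sub φ)

def litFml (l : Lit) : Fml := if l.pos then .atom l.atom else .not (.atom l.atom)

/-- The clause `C` as a disjunction. -/
noncomputable def clauseFml (C : Clause) : Fml := (C.toList.map litFml).foldr Fml.or .fls

def varsT : Trm → List ℕ
  | .var n => [n]
  | .param _ => []
  | .fn _ ts => (ts.attach.map fun t => varsT t.1).flatten
decreasing_by
  have := List.sizeOf_lt_of_mem t.2
  simp only [Trm.fn.sizeOf_spec]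
  omega

/-- The list of (free) individual variables of a clause. -/
noncomputable def clauseVars (C : Clause) : List ℕ :=
  ((C.toList.map fun l => (l.atom.terms.map varsT).flatten).flatten).dedup

/-- Shift all individual variables by `k` and turn the parameters `c̄` into the
λ-abstracted variables `ū = 0, …, k-1`. -/
def adjT (k : ℕ) : Trm → Trm
  | .var n => .var (n + k)
  | .param n => .var n
  | .fn f ts => .fn f (ts.attach.map fun t => adjT k t.1)
decreasing_by
  have := List.sizeOf_lt_of_mem t.2
  simp only [Trm.fn.sizeOf_spec]
  omega

def adjA (k : ℕ) : Atm → Atm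
  | .eq t s => .eq (adjT k t) (adjT k s)
  | .pred p ts => .pred p (ts.map (adjT k))
  | .pvar X ts => .pvar X (ts.map (adjT k))

def adjL (k : ℕ) (l : Lit) : Lit := ⟨l.pos, adjA k l.atom⟩

def adjC (k : ℕ) (C : Clause) : Clause := C.map (adjL k)

/-- The (finite, first-order) closure predicate `Res^p_P` of a *one-sided*
`X`-pointed clause `P = L(t̄) ∨ C_P`, built syntactically from
`Res^U_P(c̄) = {L(c̄)^⊥, t̄ ≉ c̄ ∨ C_P}`: a conjunction of universally closed
clauses if the designated literal is negative, a disjunction of existentially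
closed negated clauses if it is positive. -/
noncomputable def ResPFml (P : PClause) : FOPred :=
  match P.lit.atom with
  | .pvar X ts =>
    let k := ts.length
    let uvars : List Trm := (List.range k).map Trm.var
    let unitF : Fml := clauseFml ((⟨!P.lit.pos, Atm.pvar X uvars⟩ : Lit) ::ₘ (0 : Clause))
    let resCl : Clause := ↑(neqLits (ts.map (adjT k)) uvars) + adjC k P.rest
    let vlist : List ℕ := (clauseVars resCl).filter (fun n => k ≤ n)
    if P.lit.pos then
      ⟨k, Fml.or (Fml.not unitF) (vlist.foldr Fml.ex (Fml.not (clauseFml resCl)))⟩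
    else
      ⟨k, Fml.and unitF (vlist.foldr Fml.all (clauseFml resCl))⟩
  | _ => ⟨0, Fml.fls⟩

def isPurDel : CStep → Bool
  | .purDel _ => true
  | _ => false

def isXLit {d : ℕ} (Xs : Fin d → ℕ) (l : Lit) : Bool :=
  match l.atom with
  | .pvar Y _ => (List.ofFn Xs).contains Y
  | _ => false

/-- The number of `X̄`-literals of a clause. -/
def countXLits {d : ℕ} (Xs : Fin d → ℕ) (C : Clause) : ℕ :=
  Multiset.countP (fun l => isXLit Xs l = true) C

/-- The syntactic witness transformation `T_S` for one-sided derivations. -/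
noncomputable def TwitS {d : ℕ} (Xs : Fin d → ℕ) (S : CStep) (es : Fin d → FOPred) :
    Fin d → FOPred :=
  match S with
  | .extPurDel X b =>
      fun i => if Xs i = X then ⟨(es i).arity, if b then Fml.tru else Fml.fls⟩ else es i
  | .purDel P =>
      fun i => if pvarOf P = some (Xs i) then
          ⟨(ResPFml P).arity,
            substPvF (fun Y => if h : ∃ j, Xs j = Y then some (es h.choose) else none)
              (ResPFml P).body⟩
        else es i
  | _ => es

/-- The syntactic witness `wit(D)` constructed backwards along `D` from the
placeholder witness `base`. -/
noncomputable def witDerivS {d : ℕ} (Xs : Fin d → ℕ) (base : Fin d → FOPred)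
    (D : List CStep) : Fin d → FOPred :=
  D.foldr (fun S acc => TwitS Xs S acc) base

/-- The placeholder witness `λū.W(ū)` for a fresh predicate variable `W`. -/
def placeholder (Wv arity : ℕ) : FOPred :=
  ⟨arity, .atom (.pvar Wv ((List.range arity).map Trm.var))⟩

/-! ### Size estimates for substitutions -/

theorem sizeT_fn (f : ℕ) (ts : List Trm) : sizeT (.fn f ts) = 1 + (ts.map sizeT).sum := by
  rw [sizeT, List.attach_map_val (f := sizeT)]

theorem substTrm_fn (σ : Subst) (f : ℕ) (ts : List Trm) :
    substTrm σ (.fn f ts) = .fn f (ts.map (substTrm σ)) := by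
  rw [substTrm, List.attach_map_val (f := substTrm σ)]

theorem one_le_sizeT (t : Trm) : 1 ≤ sizeT t := by
  cases t with
  | var n => simp [sizeT]
  | param n => simp [sizeT]
  | fn f ts => simp [sizeT_fn]

theorem sizeT_le_substTrm (σ : Subst) : ∀ t : Trm, sizeT t ≤ sizeT (substTrm σ t)
  | .var n => by
      rw [sizeT, substTrm]
      exact one_le_sizeT _
  | .param n => by rw [substTrm]
  | .fn f ts => by
      rw [substTrm_fn, sizeT_fn, sizeT_fn, List.map_map]
      refine Nat.add_le_add_left (List.sum_le_sum fun t _ => ?_) 1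
      exact sizeT_le_substTrm σ t
termination_by t => sizeOf t
decreasing_by
  have := List.sizeOf_lt_of_mem ‹t ∈ ts›
  simp only [Trm.fn.sizeOf_spec]
  omega

theorem sizeA_le_substAtm (σ : Subst) (a : Atm) : sizeA a ≤ sizeA (substAtm σ a) := by
  cases a with
  | eq t s =>
    have ht := sizeT_le_substTrm σ t
    have hs := sizeT_le_substTrm σ s
    simp only [substAtm, sizeA]
    omega
  | pred q ts =>
    simp only [substAtm, sizeA, List.map_map]
    exact Nat.add_le_add_left (List.sum_le_sum fun t _ => sizeT_le_substTrm σ t) 1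
  | pvar q ts =>
    simp only [substAtm, sizeA, List.map_map]
    exact Nat.add_le_add_left (List.sum_le_sum fun t _ => sizeT_le_substTrm σ t) 1

theorem sizeF_le_substTF (σ : Subst) (φ : Fml) : sizeF φ ≤ sizeF (substTF σ φ) := by
  induction φ with
  | atom a => exact sizeA_le_substAtm σ a
  | _ => simp only [substTF, sizeF]; omega

/-- The number of occurrences of the predicate variable `X` in an atom. -/
def occA (X : ℕ) : Atm → ℕ
  | .pvar Y _ => if Y = X then 1 else 0
  | _ => 0

/-- The number of occurrences of the predicate variable `X` in a formula. -/
def occF (X : ℕ) : Fml → ℕ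
  | .atom a => occA X a
  | .tru => 0
  | .fls => 0
  | .not φ => occF X φ
  | .and φ ψ => occF X φ + occF X ψ
  | .or φ ψ => occF X φ + occF X ψ
  | .imp φ ψ => occF X φ + occF X ψ
  | .all _ φ => occF X φ
  | .ex _ φ => occF X φ

/-- Every occurrence of `X` contributes at least the size of the predicate
substituted for it. -/
theorem occF_mul_le_sizeF_substPvF {X : ℕ} {sub : ℕ → Option FOPred} {e : FOPred}
    (h : sub X = some e) (φ : Fml) :
    occF X φ * sizeF e.body ≤ sizeF (substPvF sub φ) := by
  induction φ with
  | atom a =>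
    cases a with
    | eq t s => simp [occF, occA]
    | pred q ts => simp [occF, occA]
    | pvar Y ts =>
      by_cases hY : Y = X
      · subst hY
        simp only [occF, occA, if_true, one_mul, substPvF, h]
        exact sizeF_le_substTF _ _
      · simp [occF, occA, hY]
  | tru => simp [occF]
  | fls => simp [occF]
  | _ => simp only [occF, substPvF, sizeF, add_mul]; omega

theorem occF_litFml (X : ℕ) (l : Lit) : occF X (litFml l) = occA X l.atom := by
  unfold litFml
  split <;> rfl

theorem occF_clauseFml (X : ℕ) (C : Clause) :
    occF X (clauseFml C) = (C.map fun l => occA X l.atom).sum := by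
  have key : ∀ L : List Lit,
      occF X ((L.map litFml).foldr Fml.or .fls) = (L.map fun l => occA X l.atom).sum := by
    intro L
    induction L with
    | nil => rfl
    | cons l L ih => simp [occF, occF_litFml, ih]
  rw [clauseFml, key, ← Multiset.sum_coe, ← Multiset.map_coe, Multiset.coe_toList]

theorem occF_foldr_ex (X : ℕ) (vs : List ℕ) (φ : Fml) :
    occF X (vs.foldr Fml.ex φ) = occF X φ := by
  induction vs with
  | nil => rfl
  | cons v vs ih => simpa [occF] using ih

theorem occA_adjA (X k : ℕ) (a : Atm) : occA X (adjA k a) = occA X a := by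
  cases a <;> rfl

theorem sum_occA_adjC (X k : ℕ) (C : Clause) :
    ((adjC k C).map fun l => occA X l.atom).sum = (C.map fun l => occA X l.atom).sum := by
  simp [adjC, Multiset.map_map, Function.comp_def, adjL, occA_adjA]

/-- Replacing `X` by `e` in the closure predicate of a positive `X`-pointed clause
multiplies the size of `e` by at least the number of `X`-literals. -/
theorem mul_lt_sizeF_substPvF_ResPFml {X : ℕ} {sub : ℕ → Option FOPred} {e : FOPred}
    (h : sub X = some e) {ts : List Trm} (C : Clause) :
    (1 + (C.map fun l => occA X l.atom).sum) * sizeF e.body <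
      sizeF (substPvF sub (ResPFml ⟨⟨true, .pvar X ts⟩, C⟩).body) := by
  simp only [ResPFml, if_true, substPvF, sizeF]
  refine lt_of_lt_of_le ?_ (Nat.add_le_add (Nat.add_le_add_left
    (occF_mul_le_sizeF_substPvF h _) 1) (occF_mul_le_sizeF_substPvF h _))
  rw [occF_foldr_ex, occF, occF_clauseFml, occF_clauseFml, Multiset.map_add, Multiset.sum_add,
    sum_occA_adjC]
  simp only [Multiset.map_cons, Multiset.map_zero, Multiset.sum_cons, Multiset.sum_zero, occA,
    if_true, add_mul]
  omega

/-! ### The clauses `⋁ⱼ X(c_{i,j})` and the derivation deleting them -/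

/-- The literal `X(c)` for the constant `c` numbered `m`. -/
def constLit (X m : ℕ) : Lit := ⟨true, .pvar X [.fn m []]⟩

/-- The pointed clause `X(c_{i,0}) ∨ ⋁_{1 ≤ j ≤ m} X(c_{i,j})` with first literal
designated. -/
def constClause (X m i : ℕ) : PClause :=
  ⟨constLit X (Nat.pair i 0),
    (Multiset.range m).map fun j => constLit X (Nat.pair i (j + 1))⟩

theorem mem_constClause {X m i : ℕ} {l : Lit} (h : l ∈ (constClause X m i).toClause) :
    ∃ j, l = constLit X (Nat.pair i j) := by
  simp only [constClause, PClause.toClause, Multiset.mem_cons, Multiset.mem_map] at h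
  rcases h with rfl | ⟨j, -, rfl⟩
  exacts [⟨_, rfl⟩, ⟨_, rfl⟩]

theorem constClause_toClause_injective (X m : ℕ) :
    Function.Injective fun i => (constClause X m i).toClause := by
  intro i i' h
  have hmem : constLit X (Nat.pair i 0) ∈ (constClause X m i').toClause := by
    rw [← show (constClause X m i).toClause = (constClause X m i').toClause from h]
    exact Multiset.mem_cons_self _ _
  obtain ⟨j, hj⟩ := mem_constClause hmem
  simp only [constLit, Lit.mk.injEq, Atm.pvar.injEq, List.cons.injEq, Trm.fn.injEq,
    Nat.pair_eq_pair] at hj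
  tauto

theorem not_isPResolvent_constClause {X m i i' : ℕ} {R : Clause} :
    ¬ IsPResolvent (constClause X m i) (constClause X m i').toClause R := by
  rintro ⟨b, Y, ts, ss, D', hP, -, hD, -⟩
  have hmem : (⟨!b, .pvar Y ss⟩ : Lit) ∈ (constClause X m i').toClause := by
    rw [hD]
    exact Multiset.mem_cons_self _ _
  obtain ⟨j, hj⟩ := mem_constClause hmem
  simp only [constClause, constLit, Lit.mk.injEq] at hP hj
  simp [← hP.1] at hj

theorem countXLits_constClause (X m i : ℕ) :
    countXLits (fun _ : Fin 1 => X) (constClause X m i).toClause = m + 1 := by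
  have h : ∀ l ∈ (constClause X m i).toClause, isXLit (fun _ : Fin 1 => X) l = true := by
    intro l hl
    obtain ⟨j, rfl⟩ := mem_constClause hl
    simp [isXLit, constLit]
  rw [countXLits, Multiset.countP_eq_card.mpr h]
  simp [constClause, PClause.toClause]

theorem oneSided_constClause (X m i : ℕ) : OneSided (constClause X m i) := by
  intro Y ts _ l hl ss _
  obtain ⟨j, rfl⟩ := mem_constClause (X := X) (m := m) (i := i) (Multiset.mem_cons_of_mem hl)
  rfl

/-- The clause set consisting of the clauses with indices in `L`. -/
def constSet (X m : ℕ) (L : List ℕ) : Set Clause :=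
  {C | ∃ i ∈ L, C = (constClause X m i).toClause}

/-- The derivation deleting the clauses with indices in `L` one after another. -/
def constDeriv (X m : ℕ) (L : List ℕ) : List CStep :=
  L.map fun i => .purDel (constClause X m i)

theorem apply_purDel_constSet {X m i : ℕ} {L : List ℕ} (hi : i ∉ L) :
    CStep.apply (constSet X m (i :: L)) (.purDel (constClause X m i)) = constSet X m L := by
  ext C
  simp only [CStep.apply, constSet, Set.mem_sdiff, Set.mem_ofPred_eq, Set.mem_singleton_iff,
    List.mem_cons]
  constructor
  · rintro ⟨⟨i', rfl | hi', rfl⟩, hne⟩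
    · exact absurd rfl hne
    · exact ⟨i', hi', rfl⟩
  · rintro ⟨i', hi', rfl⟩
    refine ⟨⟨i', Or.inr hi', rfl⟩, fun h => hi ?_⟩
    rwa [← constClause_toClause_injective X m h]

theorem derivOK_constDeriv (X m : ℕ) (Red : Clause → Set Clause → Prop) {L : List ℕ}
    (hL : L.Nodup) :
    derivOK (Set.range (fun _ : Fin 1 => X)) Red (constSet X m L) (constDeriv X m L) := by
  induction L with
  | nil => trivial
  | cons i L ih =>
    rw [List.nodup_cons] at hL
    refine ⟨⟨⟨X, ⟨0, rfl⟩, _, rfl⟩, ⟨i, List.mem_cons_self, rfl⟩, ?_⟩, ?_⟩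
    · rintro _ ⟨⟨i', -, rfl⟩, -⟩ R hR
      exact absurd hR not_isPResolvent_constClause
    · rw [apply_purDel_constSet hL.1]
      exact ih hL.2

theorem applyDeriv_constDeriv (X m : ℕ) {L : List ℕ} (hL : L.Nodup) :
    applyDeriv (constSet X m L) (constDeriv X m L) = ∅ := by
  induction L with
  | nil => simp [constSet, constDeriv, applyDeriv]
  | cons i L ih =>
    rw [List.nodup_cons] at hL
    simp only [constDeriv, List.map_cons, applyDeriv]
    rw [apply_purDel_constSet hL.1]
    exact ih hL.2

theorem mul_lt_sizeF_TwitS_constClause (X m i : ℕ) (es : Fin 1 → FOPred) :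
    (m + 1) * sizeF (es 0).body <
      sizeF (TwitS (fun _ : Fin 1 => X) (.purDel (constClause X m i)) es 0).body := by
  let sub : ℕ → Option FOPred := fun Y =>
    if h : ∃ j : Fin 1, (fun _ : Fin 1 => X) j = Y then some (es h.choose) else none
  have hsub : sub X = some (es 0) := by
    have h : ∃ j : Fin 1, (fun _ : Fin 1 => X) j = X := ⟨0, rfl⟩
    exact (dif_pos h).trans (congrArg (fun j => some (es j)) (Subsingleton.elim h.choose 0))
  have key := mul_lt_sizeF_substPvF_ResPFml hsub (ts := [.fn (Nat.pair i 0) []])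
    (constClause X m i).rest
  have hsum : ((constClause X m i).rest.map fun l => occA X l.atom).sum = m := by
    simp [constClause, Multiset.map_map, constLit, occA]
  rw [hsum, Nat.add_comm 1 m] at key
  simp only [TwitS]
  rw [if_pos (show pvarOf (constClause X m i) = some X from rfl)]
  exact key

theorem sizeF_witDerivS_constDeriv (X W m : ℕ) (L : List ℕ) :
    L.length ≤ sizeF ((witDerivS (fun _ : Fin 1 => X) (fun _ => placeholder W 1)
        (constDeriv X m L)) 0).body ∧
      (m + 1) ^ L.length ≤ sizeF ((witDerivS (fun _ : Fin 1 => X) (fun _ => placeholder W 1)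
        (constDeriv X m L)) 0).body := by
  induction L with
  | nil => simp [witDerivS, constDeriv, placeholder, sizeF, sizeA]
  | cons i L ih =>
    have step := mul_lt_sizeF_TwitS_constClause X m i
      (witDerivS (fun _ : Fin 1 => X) (fun _ => placeholder W 1) (constDeriv X m L))
    change _ < sizeF ((witDerivS (fun _ : Fin 1 => X) (fun _ => placeholder W 1)
      (constDeriv X m (i :: L))) 0).body at step
    rw [List.length_cons]
    constructor
    · exact (ih.1.trans (Nat.le_mul_of_pos_left _ m.succ_pos)).trans_lt step
    · rw [pow_succ']
      exact (Nat.mul_le_mul_left _ ih.2).trans step.le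

/-- **Lower bound on witness size.** For all `p, n ≥ 1` there are
a clause set `N` and a one-sided `X`-eliminating 𝒞-derivation `D` from `N`
(whose side conditions hold for every redundancy notion) with exactly `p`
purified pointed clauses, each containing at most `n` `X`-literals and `n` being
the maximum such number, such that if `n = 1` then `|wit(D)| = Ω(p)`
(concretely, `≥ p`) and if `n > 1` then `|wit(D)| = Ω(nᵖ)` (concretely, `≥ nᵖ`).
(One may take `N = { ⋁_{j=1}^n X(c_{i,j}) | 1 ≤ i ≤ p }`.) -/
theorem witness_size_lower_bound
    (X : ℕ) (W : ℕ) (p n : ℕ) (hp : 1 ≤ p) (hn : 1 ≤ n) :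
    ∃ (N : Set Clause) (D : List CStep),
      (∀ Red : Clause → Set Clause → Prop,
        derivOK (Set.range (fun _ : Fin 1 => X)) Red N D) ∧
      (∀ P, CStep.purDel P ∈ D →
        OneSided P ∧ countXLits (fun _ : Fin 1 => X) P.toClause ≤ n) ∧
      (∃ P, CStep.purDel P ∈ D ∧ countXLits (fun _ : Fin 1 => X) P.toClause = n) ∧
      (D.filter (fun S => isPurDel S = true)).length = p ∧
      (∀ C ∈ applyDeriv N D, ¬ OccursIn X C) ∧
      (n = 1 →
        p ≤ sizeF ((witDerivS (fun _ : Fin 1 => X) (fun _ => placeholder W 1) D) 0).body) ∧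
      (1 < n →
        n ^ p ≤ sizeF ((witDerivS (fun _ : Fin 1 => X) (fun _ => placeholder W 1) D) 0).body) := by
  obtain ⟨m, rfl⟩ : ∃ m, n = m + 1 := ⟨n - 1, by omega⟩
  have hsize := sizeF_witDerivS_constDeriv X W m (List.range p)
  rw [List.length_range] at hsize
  refine ⟨constSet X m (List.range p), constDeriv X m (List.range p),
    fun Red => derivOK_constDeriv X m Red List.nodup_range, ?_, ?_, ?_, ?_,
    fun _ => hsize.1, fun _ => hsize.2⟩
  · intro P hP
    simp only [constDeriv, List.mem_map, CStep.purDel.injEq] at hP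
    obtain ⟨i, -, rfl⟩ := hP
    exact ⟨oneSided_constClause X m i, (countXLits_constClause X m i).le⟩
  · exact ⟨constClause X m 0, List.mem_map.mpr ⟨0, List.mem_range.mpr hp, rfl⟩,
      countXLits_constClause X m 0⟩
  · rw [List.filter_eq_self.mpr]
    · simp [constDeriv]
    · intro S hS
      obtain ⟨i, -, rfl⟩ := List.mem_map.mp hS
      rfl
  · rw [applyDeriv_constDeriv X m List.nodup_range]
    exact fun C hC => hC.elim

end Scan
end
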